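/- arXiv:2408.16105 — 7 statements merged into one kernel-verified Lean document; each statement's English description precedes it below -/
import Mathlib

section
/- One step of the first-order SAV scheme dissipates the modified entropy: let Δt > 0, Hⁿ > 0, rⁿ, rⁿ⁺¹ ∈ ℝ, and let fⁿ, fⁿ⁺¹, Qⁿ : Ω → ℝ with fⁿ(v) > 0 a.e., Qⁿ·log fⁿ integrable, satisfying (i) fⁿ⁺¹(v) = fⁿ(v) + Δt·(rⁿ⁺¹/√Hⁿ)·Qⁿ(v) a.e. and (ii) rⁿ⁺¹ − rⁿ = (1/(2√Hⁿ))·∫_Ω log fⁿ(v)·(fⁿ⁺¹(v) − fⁿ(v)) dv. Then (rⁿ⁺¹)² − (rⁿ)² = −(rⁿ⁺¹ − rⁿ)² + (Δt·(rⁿ⁺¹)²/Hⁿ)·∫_Ω Qⁿ(v) log fⁿ(v) dv. Consequently, if ∫_Ω Qⁿ log fⁿ dv ≤ 0, then (rⁿ⁺¹)² ≤ (rⁿ)². -/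
open MeasureTheory

/-- One step of the first-order SAV scheme dissipates the modified entropy. -/
theorem sav1st_modified_entropy_dissipation
    (d : ℕ) (Ω : Set (EuclideanSpace ℝ (Fin d))) (hΩ : MeasurableSet Ω)
    (Δt Hn rn rnp1 : ℝ) (hΔt : 0 < Δt) (hHn : 0 < Hn)
    (fn fnp1 Qn : EuclideanSpace ℝ (Fin d) → ℝ)
    (hpos : ∀ᵐ v ∂(volume.restrict Ω), 0 < fn v)
    (hint : IntegrableOn (fun v => Qn v * Real.log (fn v)) Ω)
    (hupd : ∀ᵐ v ∂(volume.restrict Ω),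
      fnp1 v = fn v + Δt * (rnp1 / Real.sqrt Hn) * Qn v)
    (hr : rnp1 - rn =
      (1 / (2 * Real.sqrt Hn)) * ∫ v in Ω, Real.log (fn v) * (fnp1 v - fn v)) :
    rnp1 ^ 2 - rn ^ 2 =
      -(rnp1 - rn) ^ 2 +
        (Δt * rnp1 ^ 2 / Hn) * ∫ v in Ω, Qn v * Real.log (fn v) ∧
    ((∫ v in Ω, Qn v * Real.log (fn v)) ≤ 0 → rnp1 ^ 2 ≤ rn ^ 2) := by
  have hI : ∫ v in Ω, Real.log (fn v) * (fnp1 v - fn v) =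
      Δt * (rnp1 / Real.sqrt Hn) * ∫ v in Ω, Qn v * Real.log (fn v) := by
    rw [← integral_const_mul]
    refine integral_congr_ae ?_
    filter_upwards [hupd] with v hv
    rw [hv]
    ring
  have hstep : rnp1 - rn = Δt * rnp1 / (2 * Hn) * ∫ v in Ω, Qn v * Real.log (fn v) := by
    have hs : Real.sqrt Hn ≠ 0 := (Real.sqrt_pos.2 hHn).ne'
    have hsq : Real.sqrt Hn ^ 2 = Hn := Real.sq_sqrt hHn.le
    rw [hr, hI]
    nth_rewrite 3 [← hsq]
    field_simp
  have hid : rnp1 ^ 2 - rn ^ 2 = -(rnp1 - rn) ^ 2 +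
      (Δt * rnp1 ^ 2 / Hn) * ∫ v in Ω, Qn v * Real.log (fn v) := by
    have hmul : 2 * rnp1 * (rnp1 - rn) =
        (Δt * rnp1 ^ 2 / Hn) * ∫ v in Ω, Qn v * Real.log (fn v) := by
      rw [hstep]
      field_simp
    linear_combination hmul
  refine ⟨hid, fun hQ => ?_⟩
  have hcoef : 0 ≤ Δt * rnp1 ^ 2 / Hn := by positivity
  linarith [mul_nonpos_of_nonneg_of_nonpos hcoef hQ, sq_nonneg (rnp1 - rn)]
end

section
/- The modified entropy of the first-order SAV scheme is non-increasing along the whole discrete trajectory: let Δt > 0 and let (fₙ)ₙ, (Qₙ)ₙ be sequences of functions Ω → ℝ, (rₙ)ₙ a real sequence and (Hₙ)ₙ a sequence of positive reals such that for every n ≥ 0: fₙ(v) > 0 a.e., Qₙ·log fₙ is integrable, ∫_Ω Qₙ log fₙ dv ≤ 0, fₙ₊₁(v) = fₙ(v) + Δt·(rₙ₊₁/√Hₙ)·Qₙ(v) a.e., and rₙ₊₁ − rₙ = (1/(2√Hₙ))·∫_Ω log fₙ·(fₙ₊₁ − fₙ) dv. Then the sequence n ↦ (rₙ)² is non-increasing.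 -/
open MeasureTheory

/-- The modified entropy of the first-order SAV scheme is non-increasing along
the whole discrete trajectory. -/
theorem sav1st_modified_entropy_antitone
    (d : ℕ) (Ω : Set (EuclideanSpace ℝ (Fin d))) (hΩ : MeasurableSet Ω)
    (Δt : ℝ) (hΔt : 0 < Δt)
    (f Q : ℕ → EuclideanSpace ℝ (Fin d) → ℝ) (r H : ℕ → ℝ)
    (hH : ∀ n, 0 < H n)
    (hpos : ∀ n, ∀ᵐ v ∂(volume.restrict Ω), 0 < f n v)
    (hint : ∀ n, IntegrableOn (fun v => Q n v * Real.log (f n v)) Ω)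
    (hdiss : ∀ n, (∫ v in Ω, Q n v * Real.log (f n v)) ≤ 0)
    (hupd : ∀ n, ∀ᵐ v ∂(volume.restrict Ω),
      f (n + 1) v = f n v + Δt * (r (n + 1) / Real.sqrt (H n)) * Q n v)
    (hr : ∀ n, r (n + 1) - r n =
      (1 / (2 * Real.sqrt (H n))) *
        ∫ v in Ω, Real.log (f n v) * (f (n + 1) v - f n v)) :
    Antitone fun n => (r n) ^ 2 := by
  refine antitone_nat_of_succ_le fun n => ?_
  have hI : (∫ v in Ω, Real.log (f n v) * (f (n + 1) v - f n v)) =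
      Δt * (r (n + 1) / Real.sqrt (H n)) * ∫ v in Ω, Q n v * Real.log (f n v) := by
    rw [← integral_const_mul]
    refine integral_congr_ae ?_
    filter_upwards [hupd n] with v hv
    rw [hv]
    ring
  obtain ⟨k, hk, hkr⟩ : ∃ k ≤ 0, r (n + 1) - r n = k * r (n + 1) := by
    refine ⟨1 / (2 * Real.sqrt (H n)) * (Δt / Real.sqrt (H n)) *
      ∫ v in Ω, Q n v * Real.log (f n v),
      mul_nonpos_of_nonneg_of_nonpos (by positivity) (hdiss n), ?_⟩
    rw [hr n, hI]
    ring
  have hrn : r n = (1 - k) * r (n + 1) := by linarith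
  simp only [hrn, mul_pow]
  exact le_mul_of_one_le_left (sq_nonneg _) (one_le_pow₀ (by linarith))
end

section
/- One step of the second-order BDF2 SAV scheme dissipates the modified entropy: let Δt > 0, H* > 0, rⁿ⁻¹, rⁿ, rⁿ⁺¹ ∈ ℝ, f* : Ω → ℝ with f*(v) > 0 a.e., and fⁿ⁻¹, fⁿ, fⁿ⁺¹, Q* : Ω → ℝ with Q*·log f* integrable, satisfying (i) 3fⁿ⁺¹ − 4fⁿ + fⁿ⁻¹ = 2Δt·(rⁿ⁺¹/√H*)·Q* a.e. and (ii) 3rⁿ⁺¹ − 4rⁿ + rⁿ⁻¹ = (1/(2√H*))·∫_Ω log f*·(3fⁿ⁺¹ − 4fⁿ + fⁿ⁻¹) dv. Define H̃ⁿ = (1/2)(rⁿ)² + (1/2)(2rⁿ − rⁿ⁻¹)² and H̃ⁿ⁺¹ = (1/2)(rⁿ⁺¹)² + (1/2)(2rⁿ⁺¹ − rⁿ)². Then H̃ⁿ⁺¹ − H̃ⁿ = −(1/2)(rⁿ⁺¹ − 2rⁿ + rⁿ⁻¹)² + (Δt·(rⁿ⁺¹)²/H*)·∫_Ω Q* log f*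 dv. Consequently, if ∫_Ω Q* log f* dv ≤ 0, then H̃ⁿ⁺¹ ≤ H̃ⁿ. -/
open MeasureTheory

/-- One step of the second-order BDF2 SAV scheme dissipates the modified
entropy. -/
theorem sav2nd_modified_entropy_dissipation
    (d : ℕ) (Ω : Set (EuclideanSpace ℝ (Fin d))) (hΩ : MeasurableSet Ω)
    (Δt Hstar rnm1 rn rnp1 : ℝ) (hΔt : 0 < Δt) (hHstar : 0 < Hstar)
    (fstar fnm1 fn fnp1 Qstar : EuclideanSpace ℝ (Fin d) → ℝ)
    (hpos : ∀ᵐ v ∂(volume.restrict Ω), 0 < fstar v)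
    (hint : IntegrableOn (fun v => Qstar v * Real.log (fstar v)) Ω)
    (hupd : ∀ᵐ v ∂(volume.restrict Ω),
      3 * fnp1 v - 4 * fn v + fnm1 v =
        2 * Δt * (rnp1 / Real.sqrt Hstar) * Qstar v)
    (hr : 3 * rnp1 - 4 * rn + rnm1 =
      (1 / (2 * Real.sqrt Hstar)) *
        ∫ v in Ω, Real.log (fstar v) * (3 * fnp1 v - 4 * fn v + fnm1 v)) :
    ((1 / 2) * rnp1 ^ 2 + (1 / 2) * (2 * rnp1 - rn) ^ 2) -
        ((1 / 2) * rn ^ 2 + (1 / 2) * (2 * rn - rnm1) ^ 2) =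
      -(1 / 2) * (rnp1 - 2 * rn + rnm1) ^ 2 +
        (Δt * rnp1 ^ 2 / Hstar) * ∫ v in Ω, Qstar v * Real.log (fstar v) ∧
    ((∫ v in Ω, Qstar v * Real.log (fstar v)) ≤ 0 →
      (1 / 2) * rnp1 ^ 2 + (1 / 2) * (2 * rnp1 - rn) ^ 2 ≤
        (1 / 2) * rn ^ 2 + (1 / 2) * (2 * rn - rnm1) ^ 2) := by
  have hI : (∫ v in Ω, Real.log (fstar v) * (3 * fnp1 v - 4 * fn v + fnm1 v)) =
      2 * Δt * (rnp1 / Real.sqrt Hstar) * ∫ v in Ω, Qstar v * Real.log (fstar v) := by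
    rw [← integral_const_mul]
    refine integral_congr_ae ?_
    filter_upwards [hupd] with v hv
    rw [hv]
    ring
  rw [hI] at hr
  generalize (∫ v in Ω, Qstar v * Real.log (fstar v)) = I at hr ⊢
  have hscaled : rnp1 * (3 * rnp1 - 4 * rn + rnm1) = Δt * rnp1 ^ 2 / Hstar * I := by
    have hsqrt : 0 < Real.sqrt Hstar := Real.sqrt_pos.mpr hHstar
    rw [hr]
    nth_rewrite 3 [← Real.sq_sqrt hHstar.le]
    field_simp
  refine ⟨by linear_combination hscaled, fun hIle => ?_⟩
  have hdiss : Δt * rnp1 ^ 2 / Hstar * I ≤ 0 :=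
    mul_nonpos_of_nonneg_of_nonpos (by positivity) hIle
  nlinarith [sq_nonneg (rnp1 - 2 * rn + rnm1)]
end

section
/- The Crank–Nicolson SAV scheme dissipates the modified entropy: let Δt > 0, H* > 0, rⁿ, rⁿ⁺¹ ∈ ℝ, f* : Ω → ℝ with f*(v) > 0 a.e., and fⁿ, fⁿ⁺¹, Q* : Ω → ℝ with Q*·log f* integrable, satisfying (i) fⁿ⁺¹ − fⁿ = Δt·((rⁿ⁺¹ + rⁿ)/(2√H*))·Q* a.e. and (ii) rⁿ⁺¹ − rⁿ = (1/(2√H*))·∫_Ω log f*·(fⁿ⁺¹ − fⁿ) dv. Then (rⁿ⁺¹)² − (rⁿ)² = (Δt·(rⁿ⁺¹ + rⁿ)²/(4H*))·∫_Ω Q* log f* dv, which is ≤ 0 whenever ∫_Ω Q* log f* dv ≤ 0. -/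
open MeasureTheory

/-- The Crank–Nicolson SAV scheme dissipates the modified entropy. -/
theorem savCN_modified_entropy_dissipation
    (d : ℕ) (Ω : Set (EuclideanSpace ℝ (Fin d))) (hΩ : MeasurableSet Ω)
    (Δt Hstar rn rnp1 : ℝ) (hΔt : 0 < Δt) (hHstar : 0 < Hstar)
    (fstar fn fnp1 Qstar : EuclideanSpace ℝ (Fin d) → ℝ)
    (hpos : ∀ᵐ v ∂(volume.restrict Ω), 0 < fstar v)
    (hint : IntegrableOn (fun v => Qstar v * Real.log (fstar v)) Ω)
    (hupd : ∀ᵐ v ∂(volume.restrict Ω),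
      fnp1 v - fn v = Δt * ((rnp1 + rn) / (2 * Real.sqrt Hstar)) * Qstar v)
    (hr : rnp1 - rn =
      (1 / (2 * Real.sqrt Hstar)) *
        ∫ v in Ω, Real.log (fstar v) * (fnp1 v - fn v)) :
    rnp1 ^ 2 - rn ^ 2 =
      (Δt * (rnp1 + rn) ^ 2 / (4 * Hstar)) *
        ∫ v in Ω, Qstar v * Real.log (fstar v) ∧
    ((∫ v in Ω, Qstar v * Real.log (fstar v)) ≤ 0 →
      rnp1 ^ 2 - rn ^ 2 ≤ 0) := by
  have hcalc : ∫ v in Ω, Real.log (fstar v) * (fnp1 v - fn v) =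
      Δt * ((rnp1 + rn) / (2 * Real.sqrt Hstar)) *
        ∫ v in Ω, Qstar v * Real.log (fstar v) := by
    rw [← integral_const_mul]
    refine integral_congr_ae ?_
    filter_upwards [hupd] with v hv
    rw [hv]
    ring
  have hsqrt : 0 < Real.sqrt Hstar := Real.sqrt_pos.mpr hHstar
  have hsq : Real.sqrt Hstar ^ 2 = Hstar := Real.sq_sqrt hHstar.le
  have heq : rnp1 ^ 2 - rn ^ 2 =
      (Δt * (rnp1 + rn) ^ 2 / (4 * Hstar)) *
        ∫ v in Ω, Qstar v * Real.log (fstar v) := by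
    rw [hcalc] at hr
    rw [sq_sub_sq, hr, ← hsq, Real.sqrt_sq hsqrt.le]
    field_simp
    ring
  refine ⟨heq, fun hQ => ?_⟩
  rw [heq]
  exact mul_nonpos_of_nonneg_of_nonpos (by positivity) hQ
end

section
/- In the stabilized positivity-preserving SAV scheme, the auxiliary variable admits a closed-form update and is non-increasing: let Δt > 0, β ≥ 0, Hⁿ > 0, rⁿ ≥ 0, rⁿ⁺¹ ∈ ℝ, fⁿ, fⁿ⁺¹, Qⁿ : Ω → ℝ with fⁿ(v) > 0 a.e. and Qⁿ·log fⁿ integrable, satisfying (i) (1/Δt + β)·(fⁿ⁺¹ − fⁿ) = (rⁿ⁺¹/√Hⁿ)·Qⁿ a.e. and (ii) rⁿ⁺¹ − rⁿ = (1/(2√Hⁿ))·∫_Ω log fⁿ·(fⁿ⁺¹ − fⁿ) dv. Then rⁿ⁺¹·(1 − (Δt/(2Hⁿ(1 + Δt·β)))·∫_Ω Qⁿ log fⁿ dv) = rⁿ; moreover, if ∫_Ω Qⁿ log fⁿ dv ≤ 0, then 0 ≤ rⁿ⁺¹ ≤ rⁿ. -/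
open MeasureTheory

/-- In the stabilized positivity-preserving SAV scheme, the auxiliary variable
admits a closed-form update and is non-increasing. -/
theorem savP_aux_variable_update
    (d : ℕ) (Ω : Set (EuclideanSpace ℝ (Fin d))) (hΩ : MeasurableSet Ω)
    (Δt β Hn rn rnp1 : ℝ) (hΔt : 0 < Δt) (hβ : 0 ≤ β) (hHn : 0 < Hn)
    (hrn : 0 ≤ rn)
    (fn fnp1 Qn : EuclideanSpace ℝ (Fin d) → ℝ)
    (hpos : ∀ᵐ v ∂(volume.restrict Ω), 0 < fn v)
    (hint : IntegrableOn (fun v => Qn v * Real.log (fn v)) Ω)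
    (hupd : ∀ᵐ v ∂(volume.restrict Ω),
      (1 / Δt + β) * (fnp1 v - fn v) = (rnp1 / Real.sqrt Hn) * Qn v)
    (hr : rnp1 - rn =
      (1 / (2 * Real.sqrt Hn)) * ∫ v in Ω, Real.log (fn v) * (fnp1 v - fn v)) :
    rnp1 * (1 - (Δt / (2 * Hn * (1 + Δt * β))) *
        ∫ v in Ω, Qn v * Real.log (fn v)) = rn ∧
    ((∫ v in Ω, Qn v * Real.log (fn v)) ≤ 0 → 0 ≤ rnp1 ∧ rnp1 ≤ rn) := by
  have hs : 0 < √Hn := Real.sqrt_pos.mpr hHn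
  have hss : √Hn ^ 2 = Hn := Real.sq_sqrt hHn.le
  have hD : 0 < 1 + Δt * β := by positivity
  have hI : ∫ v in Ω, Real.log (fn v) * (fnp1 v - fn v) =
      (rnp1 / √Hn * (Δt / (1 + Δt * β))) * ∫ v in Ω, Qn v * Real.log (fn v) := by
    rw [← integral_const_mul]
    refine integral_congr_ae ?_
    filter_upwards [hupd] with v hv
    have hdiff : fnp1 v - fn v = Δt / (1 + Δt * β) * (rnp1 / √Hn * Qn v) := by
      rw [← hv]
      field_simp
    rw [hdiff]
    ring
  rw [hI] at hr
  generalize (∫ v in Ω, Qn v * Real.log (fn v)) = I at hr ⊢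
  have hcoef : 1 / (2 * √Hn) * (rnp1 / √Hn * (Δt / (1 + Δt * β)) * I) =
      rnp1 * (Δt / (2 * Hn * (1 + Δt * β)) * I) := by
    rw [← hss, Real.sqrt_sq hs.le]
    field_simp
  have hclosed : rnp1 * (1 - Δt / (2 * Hn * (1 + Δt * β)) * I) = rn := by
    linarith
  refine ⟨hclosed, fun hI0 => ?_⟩
  have hc : Δt / (2 * Hn * (1 + Δt * β)) * I ≤ 0 :=
    mul_nonpos_of_nonneg_of_nonpos (by positivity) hI0
  have hnonneg : 0 ≤ rnp1 :=
    nonneg_of_mul_nonneg_left (hclosed.symm ▸ hrn) (by linarith)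
  exact ⟨hnonneg, by linarith [mul_nonpos_of_nonneg_of_nonpos hnonneg hc]⟩
end

section
/- The stabilized scheme preserves positivity for all time steps: let Δt > 0, H_min > 0, r₀ ≥ 0, β ∈ ℝ, and let (fₙ)ₙ, (Qₙ⁺)ₙ, (Qₙ⁻)ₙ be sequences of functions Ω → ℝ, (rₙ)ₙ a real sequence and (Hₙ)ₙ a real sequence such that for every n ≥ 0 and v ∈ Ω: Hₙ ≥ H_min, Qₙ⁺(v) ≥ 0, 0 ≤ Qₙ⁻(v), β ≥ (r₀/√H_min)·Qₙ⁻(v), 0 ≤ rₙ₊₁ ≤ r₀, and (1 + Δt·β)·fₙ₊₁(v) = Δt·(rₙ₊₁/√Hₙ)·Qₙ⁺(v) + (1 + Δt·(β − (rₙ₊₁/√Hₙ)·Qₙ⁻(v)))·fₙ(v). If f₀(v) ≥ 0 for all v ∈ Ω, then fₙ(v) ≥ 0 for all n ≥ 0 and all v ∈ Ω. -/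
/-- The stabilized scheme preserves positivity for all time steps. -/
theorem savP_all_steps_positivity
    (d : ℕ) (Ω : Set (EuclideanSpace ℝ (Fin d)))
    (Δt Hmin r0 β : ℝ) (hΔt : 0 < Δt) (hHmin : 0 < Hmin) (hr0 : 0 ≤ r0)
    (f Qp Qm : ℕ → EuclideanSpace ℝ (Fin d) → ℝ) (r H : ℕ → ℝ)
    (hH : ∀ n, Hmin ≤ H n)
    (hQp : ∀ n, ∀ v ∈ Ω, 0 ≤ Qp n v)
    (hQm : ∀ n, ∀ v ∈ Ω, 0 ≤ Qm n v)
    (hβ : ∀ n, ∀ v ∈ Ω, (r0 / Real.sqrt Hmin) * Qm n v ≤ β)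
    (hrle : ∀ n, 0 ≤ r (n + 1) ∧ r (n + 1) ≤ r0)
    (hupd : ∀ n, ∀ v ∈ Ω,
      (1 + Δt * β) * f (n + 1) v =
        Δt * (r (n + 1) / Real.sqrt (H n)) * Qp n v +
          (1 + Δt * (β - (r (n + 1) / Real.sqrt (H n)) * Qm n v)) * f n v)
    (hf0 : ∀ v ∈ Ω, 0 ≤ f 0 v) :
    ∀ n, ∀ v ∈ Ω, 0 ≤ f n v := by
  intro n
  induction n with
  | zero => exact hf0
  | succ n ih =>
    intro v hv
    obtain ⟨hr, hr'⟩ := hrle n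
    have hcoef : 0 ≤ r (n + 1) / Real.sqrt (H n) := div_nonneg hr (Real.sqrt_nonneg _)
    have hcoef_le : r (n + 1) / Real.sqrt (H n) ≤ r0 / Real.sqrt Hmin :=
      div_le_div₀ hr0 hr' (Real.sqrt_pos.2 hHmin) (Real.sqrt_le_sqrt (hH n))
    have hloss : r (n + 1) / Real.sqrt (H n) * Qm n v ≤ β :=
      (mul_le_mul_of_nonneg_right hcoef_le (hQm n v hv)).trans (hβ n v hv)
    have hβ0 : 0 ≤ β := (mul_nonneg hcoef (hQm n v hv)).trans hloss
    have hfac : 0 < 1 + Δt * β := by positivity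
    have hweight : 0 ≤ 1 + Δt * (β - r (n + 1) / Real.sqrt (H n) * Qm n v) :=
      add_nonneg zero_le_one (mul_nonneg hΔt.le (sub_nonneg.2 hloss))
    refine nonneg_of_mul_nonneg_right ?_ hfac
    rw [hupd n v hv]
    exact add_nonneg (mul_nonneg (mul_nonneg hΔt.le hcoef) (hQp n v hv))
      (mul_nonneg hweight (ih v hv))
end

section
/- One step of the stabilized scheme dissipates the modified entropy: let Δt > 0, β ≥ 0, Hⁿ > 0, rⁿ, rⁿ⁺¹ ∈ ℝ, and let fⁿ, fⁿ⁺¹, Qⁿ : Ω → ℝ with fⁿ(v) > 0 a.e. and Qⁿ·log fⁿ integrable, satisfying (i) (1/Δt + β)·(fⁿ⁺¹ − fⁿ) = (rⁿ⁺¹/√Hⁿ)·Qⁿ a.e. and (ii) rⁿ⁺¹ − rⁿ = (1/(2√Hⁿ))·∫_Ω log fⁿ·(fⁿ⁺¹ − fⁿ) dv. Then (rⁿ⁺¹)² − (rⁿ)² + (rⁿ⁺¹ − rⁿ)² = (Δt/(1 + β·Δt))·((rⁿ⁺¹)²/Hⁿ)·∫_Ω Qⁿ log fⁿ dv. Consequently,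 if ∫_Ω Qⁿ log fⁿ dv ≤ 0, then (rⁿ⁺¹)² ≤ (rⁿ)². -/
open MeasureTheory

/-- One step of the stabilized scheme dissipates the modified entropy. -/
theorem savP_modified_entropy_dissipation
    (d : ℕ) (Ω : Set (EuclideanSpace ℝ (Fin d))) (hΩ : MeasurableSet Ω)
    (Δt β Hn rn rnp1 : ℝ) (hΔt : 0 < Δt) (hβ : 0 ≤ β) (hHn : 0 < Hn)
    (fn fnp1 Qn : EuclideanSpace ℝ (Fin d) → ℝ)
    (hpos : ∀ᵐ v ∂(volume.restrict Ω), 0 < fn v)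
    (hint : IntegrableOn (fun v => Qn v * Real.log (fn v)) Ω)
    (hupd : ∀ᵐ v ∂(volume.restrict Ω),
      (1 / Δt + β) * (fnp1 v - fn v) = (rnp1 / Real.sqrt Hn) * Qn v)
    (hr : rnp1 - rn =
      (1 / (2 * Real.sqrt Hn)) * ∫ v in Ω, Real.log (fn v) * (fnp1 v - fn v)) :
    rnp1 ^ 2 - rn ^ 2 + (rnp1 - rn) ^ 2 =
      (Δt / (1 + β * Δt)) * (rnp1 ^ 2 / Hn) *
        ∫ v in Ω, Qn v * Real.log (fn v) ∧
    ((∫ v in Ω, Qn v * Real.log (fn v)) ≤ 0 → rnp1 ^ 2 ≤ rn ^ 2) := by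
  have hD : 0 < 1 + β * Δt := by positivity
  have hs : 0 < Real.sqrt Hn := Real.sqrt_pos.2 hHn
  have hI : ∫ v in Ω, Real.log (fn v) * (fnp1 v - fn v) =
      (Δt / (1 + β * Δt) * (rnp1 / Real.sqrt Hn)) *
        ∫ v in Ω, Qn v * Real.log (fn v) := by
    rw [← integral_const_mul]
    refine integral_congr_ae ?_
    filter_upwards [hupd] with v hv
    have hstep : fnp1 v - fn v = Δt / (1 + β * Δt) * ((rnp1 / Real.sqrt Hn) * Qn v) := by
      rw [← hv]
      field_simp
    rw [hstep]
    ring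
  have key : rnp1 ^ 2 - rn ^ 2 + (rnp1 - rn) ^ 2 =
      (Δt / (1 + β * Δt)) * (rnp1 ^ 2 / Hn) * ∫ v in Ω, Qn v * Real.log (fn v) := by
    have hpolar : rnp1 ^ 2 - rn ^ 2 + (rnp1 - rn) ^ 2 = 2 * rnp1 * (rnp1 - rn) := by ring
    have hH : rnp1 ^ 2 / Hn = rnp1 ^ 2 / Real.sqrt Hn ^ 2 := by rw [Real.sq_sqrt hHn.le]
    rw [hpolar, hr, hI, hH]
    field_simp
  refine ⟨key, fun hQ => ?_⟩
  have hcoef : 0 ≤ (Δt / (1 + β * Δt)) * (rnp1 ^ 2 / Hn) := by positivity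
  have hle := mul_nonpos_of_nonneg_of_nonpos hcoef hQ
  linarith [sq_nonneg (rnp1 - rn)]
end
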